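/- Let K be an algebraically closed field of characteristic 2 and let X = {F = 0} ⊂ ℙ³_K be an irreducible quartic surface with Sing(X) finite, where F(x₁,x₂,x₃,z) = z²·x₁² + B(x₁,x₂,x₃) with B homogeneous of degree 4 (the inseparable case in which the tangent cone at the double point P = [0:0:0:1] is a double plane). Then |Sing(X)| ≤ 10. -/

import Mathlib

open MvPolynomial

noncomputable section

/-- The singular locus of the surface `{F = 0} ⊆ ℙ³_K`: the set of points of `ℙ³_K` at which
`F` and all four partial derivatives of `F` vanish (tested on every representative vector). -/
def singLocus {K : Type*} [Field K] (F : MvPolynomial (Fin 4) K) :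
    Set (Projectivization K (Fin 4 → K)) :=
  {p | ∀ (v : Fin 4 → K) (hv : v ≠ 0), Projectivization.mk K v hv = p →
      (eval v F = 0 ∧ ∀ i, eval v (pderiv i F) = 0)}

lemma finrank_restrict (K : Type*) [Field K] (d : ℕ) :
    Module.finrank K (restrictTotalDegree (Fin 2) K d) = ∑ i ∈ Finset.range (d+1), (i+1) := by
  have hb := Module.finrank_eq_nat_card_basis
    (basisRestrictSupport K {n : Fin 2 →₀ ℕ | (n.sum fun _ e => e) ≤ d})
  have h1 : Module.finrank K (restrictTotalDegree (Fin 2) K d) =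
    Nat.card {n : Fin 2 →₀ ℕ | (n.sum fun _ e => e) ≤ d} := hb
  rw [h1]
  have hs : ∀ n : Fin 2 →₀ ℕ, (n.sum fun _ e => e) = n 0 + n 1 := by
    intro n
    rw [Finsupp.sum_fintype _ _ (by simp)]
    simp
  let e : {n : Fin 2 →₀ ℕ | (n.sum fun _ e => e) ≤ d} ≃
      (Finset.range (d+1)).sigma (fun i => Finset.HasAntidiagonal.antidiagonal i) :=
    { toFun := fun n => ⟨⟨n.1 0 + n.1 1, (n.1 0, n.1 1)⟩, by
        have := n.2
        simp only [Set.mem_ofPred_eq, hs] at this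
        simp; omega⟩
      invFun := fun p => ⟨Finsupp.equivFunOnFinite.symm ![p.1.2.1, p.1.2.2], by
        have := p.2
        simp only [Finset.mem_sigma, Finset.mem_range, Finset.HasAntidiagonal.mem_antidiagonal] at this
        simp only [Set.mem_ofPred_eq, hs]
        simp; omega⟩
      left_inv := by
        rintro ⟨n, hn⟩
        ext i
        fin_cases i <;> simp
      right_inv := by
        rintro ⟨⟨k, ⟨a, b⟩⟩, hp⟩
        simp only [Finset.mem_sigma, Finset.mem_range, Finset.HasAntidiagonal.mem_antidiagonal] at hp
        obtain ⟨h1, rfl⟩ := hp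
        simp }
  rw [Nat.card_congr e, Nat.card_eq_fintype_card, Fintype.card_coe, Finset.card_sigma]
  simp

lemma exists_sep {K : Type*} [Field K] (S : Finset (Fin 2 → K)) (s : Fin 2 → K) (hs : s ∉ S) :
    ∃ p : MvPolynomial (Fin 2) K, p.totalDegree ≤ S.card ∧ eval s p ≠ 0 ∧ ∀ t ∈ S, eval t p = 0 := by
  classical
  induction S using Finset.induction_on with
  | empty => exact ⟨1, by simp⟩
  | insert a S ha ih =>
    simp only [Finset.mem_insert, not_or] at hs
    obtain ⟨p, hp, h1, h2⟩ := ih hs.2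
    obtain ⟨i, hi⟩ := Function.ne_iff.mp hs.1
    refine ⟨p * (X i - C (a i)), ?_, ?_, ?_⟩
    · rw [Finset.card_insert_of_notMem ha]
      refine (totalDegree_mul _ _).trans (Nat.add_le_add hp ?_)
      refine (totalDegree_sub_C_le _ _).trans ?_
      simp
    · simp [h1, sub_ne_zero, hi]
    · intro t ht
      rcases Finset.mem_insert.mp ht with rfl | ht
      · simp
      · simp [h2 t ht]

lemma bezout_ten {K : Type*} [Field K] (f g : MvPolynomial (Fin 2) K)
    (hf : f.totalDegree ≤ 3) (hg : g.totalDegree ≤ 3) (hf0 : f ≠ 0) (hg0 : g ≠ 0)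
    (hrel : IsRelPrime f g) (S : Finset (Fin 2 → K)) (hS : S.card = 10)
    (hz : ∀ s ∈ S, eval s f = 0 ∧ eval s g = 0) : False := by
  classical
  let V := fun d => restrictTotalDegree (Fin 2) K d
  set m := f.totalDegree with hm
  set n := g.totalDegree with hn
  let T : (V (16 - m) × V (16 - n)) →ₗ[K] MvPolynomial (Fin 2) K :=
    ((LinearMap.mulRight K f).comp (V (16-m)).subtype).coprod
      ((LinearMap.mulRight K g).comp (V (16-n)).subtype)
  have hT : ∀ a b, T (a, b) = a.1 * f + b.1 * g := by intro a b; simp [T]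
  let ev : MvPolynomial (Fin 2) K →ₗ[K] (S → K) :=
    LinearMap.pi (fun s => (aeval (R := K) (s : Fin 2 → K)).toLinearMap)
  have hev : ∀ p s, ev p s = eval s.1 p := by intro p s; simp [ev, aeval_eq_eval]
  let E := ev.domRestrict (V 16)
  have hE : LinearMap.range E = ⊤ := by
    rw [eq_top_iff, ← (Pi.basisFun K S).span_eq, Submodule.span_le]
    rintro _ ⟨s, rfl⟩
    obtain ⟨p, hp, h1, h2⟩ := exists_sep (S.erase s.1) s.1 (by simp)
    have hc := Finset.card_erase_le (s := S) (a := s.1)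
    refine ⟨⟨C (eval s.1 p)⁻¹ * p, ?_⟩, ?_⟩
    · rw [mem_restrictTotalDegree]
      refine (totalDegree_mul _ _).trans ?_
      rw [totalDegree_C]
      omega
    · ext t
      simp only [E, LinearMap.domRestrict_apply, hev, Pi.basisFun_apply, map_mul, eval_C]
      by_cases hts : t = s
      · subst hts; simp [h1]
      · rw [h2 t.1 (by simp [hts])]
        simp [hts]
  have h1 := LinearMap.finrank_range_add_finrank_ker E
  rw [hE, finrank_top, Module.finrank_fintype_fun_eq_card, Fintype.card_coe, hS] at h1
  have h2 := LinearMap.finrank_range_add_finrank_ker T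
  have h3 : Module.finrank K (LinearMap.range T) ≤ Module.finrank K (LinearMap.ker E) := by
    rw [(Submodule.equivMapOfInjective (V 16).subtype (Submodule.injective_subtype _)
      (LinearMap.ker E)).finrank_eq]
    apply Submodule.finrank_mono
    rintro _ ⟨⟨a, b⟩, rfl⟩
    have ha := (mem_restrictTotalDegree _ _ _).mp a.2
    have hb := (mem_restrictTotalDegree _ _ _).mp b.2
    have hmem : T (a, b) ∈ V 16 := by
      rw [hT, mem_restrictTotalDegree]
      refine (totalDegree_add _ _).trans (max_le ?_ ?_)
      · refine (totalDegree_mul _ _).trans ?_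
        omega
      · refine (totalDegree_mul _ _).trans ?_
        omega
    refine ⟨⟨_, hmem⟩, ?_, rfl⟩
    simp only [SetLike.mem_coe, LinearMap.mem_ker]
    ext s
    simp only [E, LinearMap.domRestrict_apply, hev, hT]
    simp [(hz s.1 s.2).1, (hz s.1 s.2).2]
  have h4 : Module.finrank K (LinearMap.ker T) ≤ Module.finrank K (V (16 - m - n)) := by
    let L : MvPolynomial (Fin 2) K →ₗ[K] MvPolynomial (Fin 2) K := LinearMap.mulRight K g
    have hL : Function.Injective L := by
      intro x y hxy
      simpa [L, hg0] using hxy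
    let P : LinearMap.ker T →ₗ[K] MvPolynomial (Fin 2) K :=
      (V (16-m)).subtype.comp ((LinearMap.fst K _ _).comp (LinearMap.ker T).subtype)
    have hP : Function.Injective P := by
      rintro ⟨⟨a, b⟩, h⟩ ⟨⟨a', b'⟩, h'⟩ hx
      rw [LinearMap.mem_ker, hT] at h h'
      have hx' : a.1 = a'.1 := hx
      rw [hx'] at h
      have : b.1 * g = b'.1 * g := by
        have := h.trans h'.symm
        exact add_left_cancel this
      have hb := mul_right_cancel₀ hg0 this
      simp [Subtype.ext_iff, hx', hb]
    rw [← LinearMap.finrank_range_of_inj hP, 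
      (Submodule.equivMapOfInjective L hL (V (16-m-n))).finrank_eq]
    apply Submodule.finrank_mono
    rintro _ ⟨⟨⟨a, b⟩, h⟩, rfl⟩
    rw [LinearMap.mem_ker, hT] at h
    have ha := (mem_restrictTotalDegree _ _ _).mp a.2
    change a.1 ∈ _
    have hd : g ∣ a.1 := by
      apply hrel.symm.dvd_of_dvd_mul_right (y := a.1) (z := f)
      rw [eq_neg_of_add_eq_zero_left h]
      exact (dvd_mul_left _ _).neg_right
    obtain ⟨c, hc⟩ := hd
    refine ⟨c, ?_, ?_⟩
    · change c ∈ restrictTotalDegree _ _ _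
      rw [mem_restrictTotalDegree]
      by_cases hc0 : c = 0
      · simp [hc0]
      rw [hc, totalDegree_mul_of_isDomain hg0 hc0] at ha
      omega
    · simp [L, hc, mul_comm]
  rw [Module.finrank_prod] at h2
  have e1 : Module.finrank K (V 16) = _ := finrank_restrict K 16
  have e2 : Module.finrank K (V (16 - m)) = _ := finrank_restrict K (16 - m)
  have e3 : Module.finrank K (V (16 - n)) = _ := finrank_restrict K (16 - n)
  have e4 : Module.finrank K (V (16 - m - n)) = _ := finrank_restrict K (16 - m - n)
  rw [e1] at h1
  rw [e2, e3] at h2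
  rw [e4] at h4
  clear e1 e2 e3 e4
  generalize Module.finrank K (LinearMap.ker E) = kE at *
  generalize Module.finrank K (LinearMap.ker T) = kT at *
  generalize Module.finrank K (LinearMap.range T) = rT at *
  clear hE hT
  clear_value m n
  interval_cases m <;> interval_cases n <;> norm_num [Finset.sum_range_succ] at h1 h2 h4 <;> omega

lemma relprime_of_finite {K : Type*} [Field K] [IsAlgClosed K] (f g : MvPolynomial (Fin 2) K)
    (hfin : {u : Fin 2 → K | eval u f = 0 ∧ eval u g = 0}.Finite) : IsRelPrime f g := by
  classical
  intro h hhf hhg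
  have key : ∀ i j : Fin 2, j ≠ i → h ≠ 0 ∧ degreeOf j h = 0 := by
    intro i j hij
    let p : MvPolynomial (Fin 2) K := ∏ s ∈ hfin.toFinset, (X i - C (s i))
    have hne : ∀ c : K, (X i - C c : MvPolynomial (Fin 2) K) ≠ 0 := by
      intro c hc
      have := congrArg (eval (fun _ => c + 1)) hc
      simp at this
    have hp0 : p ≠ 0 := Finset.prod_ne_zero_iff.mpr (fun s _ => hne _)
    have hpd : degreeOf j p = 0 := by
      apply Nat.le_zero.mp
      refine (degreeOf_prod_le _ _ _).trans ?_
      apply le_of_eq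
      apply Finset.sum_eq_zero
      intro s _
      apply Nat.le_zero.mp
      refine (degreeOf_sub_le _ _ _).trans ?_
      simp [degreeOf_X, hij]
    have hmem : p ∈ vanishingIdeal K (zeroLocus K (Ideal.span {h})) := by
      rw [mem_vanishingIdeal_iff]
      intro x hx
      rw [mem_zeroLocus_iff] at hx
      have hx := hx h (Ideal.mem_span_singleton_self h)
      rw [aeval_eq_eval] at hx ⊢
      have hx' : eval x h = 0 := hx
      change eval x p = 0
      have hxm : x ∈ hfin.toFinset := by
        obtain ⟨a, rfl⟩ := hhf
        obtain ⟨b, rfl⟩ := hhg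
        simp [hx']
      rw [map_prod]
      exact Finset.prod_eq_zero hxm (by simp)
    rw [vanishingIdeal_zeroLocus_eq_radical] at hmem
    obtain ⟨n, hn⟩ := hmem
    obtain ⟨c, hc⟩ := Ideal.mem_span_singleton.mp hn
    have hpn : p ^ n ≠ 0 := pow_ne_zero _ hp0
    have hh0 : h ≠ 0 := by rintro rfl; simp [hpn] at hc; 
    have hc0 : c ≠ 0 := by rintro rfl; simp [hpn] at hc
    refine ⟨hh0, ?_⟩
    have h1 := degreeOf_pow_le j p n
    rw [hpd, hc, degreeOf_mul_eq hh0 hc0] at h1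
    omega
  have k0 := key 1 0 (by decide)
  have k1 := key 0 1 (by decide)
  rw [isUnit_iff_totalDegree_of_isReduced]
  have ht : h.totalDegree = 0 := by
    rw [totalDegree_eq_zero_iff]
    intro m hm x
    have : m x ≤ degreeOf x h := by
      rw [degreeOf_eq_sup]; exact Finset.le_sup (f := fun m => m x) hm
    fin_cases x
    · simpa [k0.2] using this
    · simpa [k1.2] using this
  refine ⟨?_, ht⟩
  rw [totalDegree_eq_zero_iff_eq_C] at ht
  rw [isUnit_iff_ne_zero]
  intro h0
  rw [h0] at ht
  exact k0.1 (by simpa using ht)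

lemma zeros_le_nine {K : Type*} [Field K] [IsAlgClosed K] (f g : MvPolynomial (Fin 2) K)
    (hf : f.totalDegree ≤ 3) (hg : g.totalDegree ≤ 3)
    (hfin : {u : Fin 2 → K | eval u f = 0 ∧ eval u g = 0}.Finite) :
    {u : Fin 2 → K | eval u f = 0 ∧ eval u g = 0}.ncard ≤ 9 := by
  classical
  have hrel := relprime_of_finite f g hfin
  by_contra hcon
  rw [Set.ncard_eq_toFinset_card _ hfin] at hcon
  obtain ⟨S, hS, hc⟩ := Finset.exists_subset_card_eq (show 10 ≤ hfin.toFinset.card by omega)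
  have hz : ∀ s ∈ S, eval s f = 0 ∧ eval s g = 0 := fun s hs => by simpa using hS hs
  obtain ⟨s, hs⟩ := Finset.card_pos.mp (by omega : 0 < S.card)
  have nu : ∀ q : MvPolynomial (Fin 2) K, eval s q = 0 → ¬ IsUnit q := fun q hq hu => by
    have := hu.map (eval s)
    simp [hq] at this
  refine bezout_ten f g hf hg ?_ ?_ hrel S hc hz
  · rintro rfl
    exact nu g (hz s hs).2 (hrel (dvd_zero g) dvd_rfl)
  · rintro rfl
    exact nu f (hz s hs).1 (hrel dvd_rfl (dvd_zero f))

lemma eval_smul_hom {σ K : Type*} [Field K] (p : MvPolynomial σ K) (n : ℕ)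
    (hp : p.IsHomogeneous n) (a : K) (v : σ → K) : eval (a • v) p = a ^ n * eval v p := by
  rw [eval_eq, eval_eq, Finset.mul_sum]
  apply Finset.sum_congr rfl
  intro d hd
  have h := hp (mem_support_iff.mp hd)
  have h : ∑ i ∈ d.support, d i = n := by
    rw [hp.degree_eq_sum_deg_support hd]
    
  simp only [Pi.smul_apply, smul_eq_mul, mul_pow, Finset.prod_mul_distrib]
  rw [Finset.prod_pow_eq_pow_sum, h]
  ring

/-- Membership of the singular locus can be tested on one representative. -/
lemma mk_mem_singLocus {K : Type*} [Field K] (F : MvPolynomial (Fin 4) K) (hF : F.IsHomogeneous 4)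
    (v : Fin 4 → K) (hv : v ≠ 0) : Projectivization.mk K v hv ∈ singLocus F ↔
      (eval v F = 0 ∧ ∀ i, eval v (pderiv i F) = 0) := by
  constructor
  · intro h
    exact h v hv rfl
  · rintro ⟨h1, h2⟩ w hw hwv
    rw [Projectivization.mk_eq_mk_iff'] at hwv
    obtain ⟨a, rfl⟩ := hwv
    refine ⟨by rw [eval_smul_hom F 4 hF, h1, mul_zero], fun i => ?_⟩
    rw [eval_smul_hom _ 3 (by simpa using hF.pderiv), h2, mul_zero]

lemma totalDegree_dehom {K : Type*} [Field K] (p : MvPolynomial (Fin 3) K) (n : ℕ)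
    (hp : p.IsHomogeneous n) :
    (aeval (![1, X 0, X 1] : Fin 3 → MvPolynomial (Fin 2) K) p).totalDegree ≤ n := by
  rw [aeval_def, eval₂_eq]
  refine totalDegree_finsetSum_le ?_
  intro d hd
  have h : ∑ i ∈ d.support, d i = n := by
    rw [hp.degree_eq_sum_deg_support hd]
  refine (totalDegree_mul _ _).trans ?_
  rw [algebraMap_eq, totalDegree_C, zero_add]
  refine (totalDegree_finsetProd _ _).trans ?_
  rw [← h]
  apply Finset.sum_le_sum
  intro i _
  refine (totalDegree_pow _ _).trans ?_
  have : (![1, X 0, X 1] i : MvPolynomial (Fin 2) K).totalDegree ≤ 1 := by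
    fin_cases i <;> simp
  nlinarith

lemma eval_dehom {K : Type*} [Field K] (p : MvPolynomial (Fin 3) K) (u : Fin 2 → K) :
    eval u (aeval (![1, X 0, X 1] : Fin 3 → MvPolynomial (Fin 2) K) p) =
      eval ![1, u 0, u 1] p := by
  induction p using MvPolynomial.induction_on with
  | C a => simp
  | add p q hp hq => rw [map_add, map_add, hp, hq, map_add]
  | mul_X p i hp => rw [map_mul, map_mul, hp, map_mul]; congr 1; fin_cases i <;> simp

/-- The conditions for a singular point in terms of `B`. -/
lemma sing_iff {K : Type*} [Field K] [CharP K 2]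
    (B : MvPolynomial (Fin 3) K) (F : MvPolynomial (Fin 4) K)
    (hF : F = X 3 ^ 2 * X 0 ^ 2 + rename (Fin.castLE (by norm_num : (3:ℕ) ≤ 4)) B)
    (v : Fin 4 → K) :
    (eval v F = 0 ∧ ∀ i, eval v (pderiv i F) = 0) ↔
      (v 3 ^ 2 * v 0 ^ 2 = eval ![v 0, v 1, v 2] B ∧
        ∀ i, eval ![v 0, v 1, v 2] (pderiv i B) = 0) := by
  have h2 : (2 : K) = 0 := CharTwo.two_eq_zero
  have hc : v ∘ (Fin.castLE (by norm_num : (3:ℕ) ≤ 4)) = ![v 0, v 1, v 2] := by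
    ext i; fin_cases i <;> rfl
  have hinj : Function.Injective (Fin.castLE (by norm_num : (3:ℕ) ≤ 4)) :=
    Fin.castLE_injective _
  have hd : ∀ i, eval v (pderiv i F) =
      eval v (pderiv i (rename (Fin.castLE (by norm_num : (3:ℕ) ≤ 4)) B)) := by
    intro i
    rw [hF]
    simp [h2]
  have hr : ∀ i : Fin 3, eval v (pderiv (Fin.castLE (by norm_num : (3:ℕ) ≤ 4) i) F) =
      eval ![v 0, v 1, v 2] (pderiv i B) := by
    intro i
    rw [hd, pderiv_rename hinj, eval_rename, hc]
  have h3 : eval v (pderiv 3 F) = 0 := by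
    rw [hd, pderiv_eq_zero_of_notMem_vars, map_zero]
    intro hmem
    have := vars_rename _ _ hmem
    simp only [Finset.mem_image] at this
    obtain ⟨a, _, ha⟩ := this
    have := congrArg Fin.val ha
    simp at this
    omega
  have h0 : eval v F = v 3 ^ 2 * v 0 ^ 2 + eval ![v 0, v 1, v 2] B := by
    rw [hF]; simp [eval_rename, hc]
  rw [h0, CharTwo.add_eq_zero]
  refine and_congr Iff.rfl ⟨fun h i => by rw [← hr]; exact h _, fun h i => ?_⟩
  by_cases hi : i = 3
  · rw [hi, h3]
  · have := hr ⟨i.1, by omega⟩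
    rw [h] at this
    exact this

/-- Inseparable case with tangent cone a double plane: `F = z²x₁² + B(x₁,x₂,x₃)`, `X`
irreducible with finite singular locus, over an algebraically closed field of characteristic 2.
Then `|Sing(X)| ≤ 10`. -/
theorem inseparable_double_plane_singular_count_le_ten
    {K : Type*} [Field K] [IsAlgClosed K] [CharP K 2]
    (B : MvPolynomial (Fin 3) K) (hBhom : B.IsHomogeneous 4)
    (F : MvPolynomial (Fin 4) K)
    (hF : F = X 3 ^ 2 * X 0 ^ 2 + rename (Fin.castLE (by norm_num : (3:ℕ) ≤ 4)) B)
    (hFirr : Irreducible F) (hfin : (singLocus F).Finite) :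
    (singLocus F).ncard ≤ 10 := by
  classical
  have hFhom : F.IsHomogeneous 4 := by
    rw [hF]
    exact ((isHomogeneous_X_pow _ _).mul (isHomogeneous_X_pow _ _)).add hBhom.rename_isHomogeneous
  have hmem : ∀ v hv, Projectivization.mk K v hv ∈ singLocus F ↔
      (v 3 ^ 2 * v 0 ^ 2 = eval ![v 0, v 1, v 2] B ∧
        ∀ i, eval ![v 0, v 1, v 2] (pderiv i B) = 0) := fun v hv => by
    rw [mk_mem_singLocus F hFhom, sing_iff B F hF]
  have h2 : (2 : K) = 0 := CharTwo.two_eq_zero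
  have hsq : ∀ c : K, ∃ z, z ^ 2 = c := fun c => IsAlgClosed.exists_pow_nat_eq c (by norm_num)
  choose r hr using hsq
  have euler : ∀ w : Fin 3 → K, ∑ i, w i * eval w (pderiv i B) = 0 := by
    intro w
    have := congrArg (eval w) hBhom.sum_X_mul_pderiv
    simp only [map_sum, map_mul, eval_X] at this
    rw [this]
    have h4 : (4 : K) = 0 := by linear_combination 2 * h2
    simp [h4]
  let f := aeval (![1, X 0, X 1] : Fin 3 → MvPolynomial (Fin 2) K) (pderiv 1 B)
  let g := aeval (![1, X 0, X 1] : Fin 3 → MvPolynomial (Fin 2) K) (pderiv 2 B)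
  have hf : f.totalDegree ≤ 3 := totalDegree_dehom _ 3 (by simpa using hBhom.pderiv)
  have hg : g.totalDegree ≤ 3 := totalDegree_dehom _ 3 (by simpa using hBhom.pderiv)
  let Z := {u : Fin 2 → K | eval u f = 0 ∧ eval u g = 0}
  let w : (Fin 2 → K) → (Fin 4 → K) := fun u => ![1, u 0, u 1, r (eval ![1, u 0, u 1] B)]
  have hw : ∀ u, w u ≠ 0 := fun u h => by simpa [w] using congrFun h 0
  let φ : (Fin 2 → K) → Projectivization K (Fin 4 → K) := fun u => Projectivization.mk K (w u) (hw u)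
  have hφinj : Function.Injective φ := by
    intro u u' h
    simp only [φ] at h
    rw [Projectivization.mk_eq_mk_iff'] at h
    obtain ⟨a, ha⟩ := h
    have e0 := congrFun ha 0
    have e1 := congrFun ha 1
    have e2 := congrFun ha 2
    simp [w] at e0 e1 e2
    subst e0
    ext i
    fin_cases i
    · simpa using e1.symm
    · simpa using e2.symm
  have hφZ : ∀ u, φ u ∈ singLocus F ↔ u ∈ Z := by
    intro u
    simp only [φ]
    rw [hmem]
    simp only [w, Z, f, g, Set.mem_ofPred_eq, eval_dehom]
    have eu := euler ![1, u 0, u 1]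
    simp [Fin.sum_univ_three] at eu
    simp [hr, Fin.forall_fin_succ]
    intro h3 h4
    simpa [h3, h4] using eu
  have hZfin : Z.Finite := by
    apply Set.Finite.of_finite_image (f := φ) _ hφinj.injOn
    apply hfin.subset
    rintro _ ⟨u, hu, rfl⟩
    exact (hφZ u).mpr hu
  have hZ : Z.ncard ≤ 9 := zeros_le_nine f g hf hg hZfin
  have hP : (![0, 0, 0, 1] : Fin 4 → K) ≠ 0 := fun h => by simpa using congrFun h 3
  have hsub : singLocus F ⊆ insert (Projectivization.mk K _ hP) (φ '' Z) := by
    intro p hp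
    induction p using Projectivization.ind with
    | h v hv =>
    have hv' := (hmem v hv).mp hp
    by_cases hv0 : v 0 = 0
    · left
      by_cases hv12 : v 1 = 0 ∧ v 2 = 0
      · rw [Projectivization.mk_eq_mk_iff']
        refine ⟨v 3, ?_⟩
        ext i
        fin_cases i <;> simp [hv0, hv12]
      · exfalso
        have hne : ∀ t : K, (![0, v 1, v 2, t] : Fin 4 → K) ≠ 0 := fun t h => by
          apply hv12
          exact ⟨by simpa using congrFun h 1, by simpa using congrFun h 2⟩
        have hinf : (Set.range (fun t : K => Projectivization.mk K _ (hne t))).Infinite := by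
          have : Infinite K := IsAlgClosed.instInfinite
          apply Set.infinite_range_of_injective
          intro t t' h
          simp only at h
          rw [Projectivization.mk_eq_mk_iff'] at h
          obtain ⟨a, ha⟩ := h
          have e1 := congrFun ha 1
          have e2 := congrFun ha 2
          have e3 := congrFun ha 3
          simp at e1 e2 e3
          have ha1 : a = 1 := by
            by_contra hne
            have key : ∀ c : K, a * c = c → c = 0 := fun c hc => by
              have h : (a - 1) * c = 0 := by linear_combination hc
              exact (mul_eq_zero.mp h).resolve_left (sub_ne_zero.mpr hne)
            exact hv12 ⟨key _ e1, key _ e2⟩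
          rw [← e3, ha1, one_mul]
        apply hinf
        apply hfin.subset
        rintro _ ⟨t, rfl⟩
        simp only
        rw [hmem]
        simpa [hv0] using hv'
    · right
      have hvw : Projectivization.mk K v hv = φ ![v 1 / v 0, v 2 / v 0] := by
        simp only [φ]
        rw [Projectivization.mk_eq_mk_iff']
        refine ⟨v 0, ?_⟩
        have hs : (![v 0, v 1, v 2] : Fin 3 → K) = v 0 • ![1, v 1 / v 0, v 2 / v 0] := by
          ext i; fin_cases i <;> simp <;> field_simp
        have h3 : v 0 * r (eval ![1, v 1 / v 0, v 2 / v 0] B) = v 3 := by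
          have h1 := hv'.1
          rw [hs, eval_smul_hom _ 4 hBhom, ← hr (eval _ B)] at h1
          apply CharTwo.sq_injective
          have : v 0 ^ 2 ≠ 0 := pow_ne_zero _ hv0
          apply mul_right_cancel₀ this
          simp only
          rw [h1]; ring
        ext i; fin_cases i
        · simp [w]
        · simp [w]; field_simp
        · simp [w]; field_simp
        · simpa [w] using h3
      rw [hvw] at hp ⊢
      exact ⟨_, (hφZ _).mp hp, rfl⟩
  calc (singLocus F).ncard ≤ (insert (Projectivization.mk K _ hP) (φ '' Z)).ncard :=
        Set.ncard_le_ncard hsub ((hZfin.image φ).insert _)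
    _ ≤ (φ '' Z).ncard + 1 := Set.ncard_insert_le _ _
    _ ≤ Z.ncard + 1 := Nat.add_le_add_right (Set.ncard_image_le hZfin) 1
    _ ≤ 10 := by omega

end
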